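/- Every filter-based semantics is continuous: if S is a semantics defined by a filter f_S with S(D,R) = {w ∈ matches(D,R) : f_S(w)=⊤}, then S is stabilizing, and for every database D, every sequence (R_i) of regular expressions whose languages L(R_i) form a non-decreasing chain, and every regular expression R_∞ with L(R_∞) = ⋃_i L(R_i), the eventual value of the sequence S(D,R_i) equals S(D,R_∞). -/

import Mathlib

namespace RPQ

/-- Vertex identifiers. -/
abbrev V : Type := ℕ
/-- Edge identifiers. -/
abbrev Edg : Type := ℕ
/-- Labels. -/
abbrev Lab : Type := ℕ

/-- A walk: a nonempty alternating sequence `v₀,e₁,v₁,…,e_k,v_k`, encoded as the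
initial vertex together with the list of (edge, next-vertex) pairs. -/
structure Walk where
  head : V
  steps : List (Edg × V)
deriving DecidableEq

namespace Walk

def length (w : Walk) : ℕ := w.steps.length
def src (w : Walk) : V := w.head
def tgt (w : Walk) : V := (w.steps.map Prod.snd).getLastD w.head
/-- The pair of endpoints of a walk. -/
def ep (w : Walk) : V × V := (w.src, w.tgt)
def vertexList (w : Walk) : List V := w.head :: w.steps.map Prod.snd
def edgeList (w : Walk) : List Edg := w.steps.map Prod.fst
/-- Concatenation of walks (meaningful when `w.tgt = w'.src`). -/
def concat (w w' : Walk) : Walk := ⟨w.head, w.steps ++ w'.steps⟩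

end Walk

/-- A graph database. -/
structure Database where
  labels : Finset Lab
  verts : Finset V
  edges : Finset Edg
  src : Edg → V
  tgt : Edg → V
  lbl : Edg → Lab
  src_mem : ∀ e ∈ edges, src e ∈ verts
  tgt_mem : ∀ e ∈ edges, tgt e ∈ verts
  lbl_mem : ∀ e ∈ edges, lbl e ∈ labels

def chainFrom (D : Database) : V → List (Edg × V) → Prop
  | _, [] => True
  | v, (e, v') :: rest =>
      e ∈ D.edges ∧ D.src e = v ∧ D.tgt e = v' ∧ chainFrom D v' rest

/-- `w` is consistent with `D`, i.e. `w` is a walk in `D`. -/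
def Walk.Consistent (D : Database) (w : Walk) : Prop :=
  w.head ∈ D.verts ∧ chainFrom D w.head w.steps

/-- The set of walks in `D`. -/
def Walks (D : Database) : Set Walk := {w | w.Consistent D}

/-- The label of a walk in `D`: the word of its successive edge labels. -/
def Walk.label (D : Database) (w : Walk) : List Lab :=
  w.steps.map fun p => D.lbl p.1

abbrev RE := RegularExpression Lab

/-- Matches of `R` in `D`: walks in `D` whose label conforms to `R`. -/
def Matches (D : Database) (R : RE) : Set Walk :=
  {w | w.Consistent D ∧ w.label D ∈ R.matches'}

/-- A semantics maps a database and a query to a finite subset of its matches. -/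
def IsSemantics (S : Database → RE → Set Walk) : Prop :=
  ∀ D R, S D R ⊆ Matches D R ∧ (S D R).Finite

/-- `S` is walk-based. -/
def WalkBased (S : Database → RE → Set Walk) : Prop :=
  ∃ r : Set Walk → Set Walk, ∀ D R, S D R = r (Matches D R)

/-- The semantics defined by a filter `f`. -/
def FilterSem (f : Walk → Bool) (D : Database) (R : RE) : Set Walk :=
  {w ∈ Matches D R | f w = true}

/-- Componentwise inclusion of databases. -/
def Database.Sub (D D' : Database) : Prop :=
  D.labels ⊆ D'.labels ∧ D.verts ⊆ D'.verts ∧ D.edges ⊆ D'.edges ∧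
    ∀ e ∈ D.edges, D'.src e = D.src e ∧ D'.tgt e = D.tgt e ∧ D'.lbl e = D.lbl e

def IsPartialOrderRel (le : Walk → Walk → Prop) : Prop :=
  (∀ w, le w w) ∧ (∀ a b c, le a b → le b c → le a c) ∧ ∀ a b, le a b → le b a → a = b

/-- `le` is a well-partial-order on the walks of `D`. -/
def IsWpoOn (le : Walk → Walk → Prop) (D : Database) : Prop :=
  ∀ f : ℕ → Walk, (∀ n, (f n).Consistent D) → ∃ i j, i < j ∧ le (f i) (f j)

/-- Suitable order: a partial order on walks that is a wpo on `Walks D` for each `D`. -/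
def Suitable (le : Walk → Walk → Prop) : Prop :=
  IsPartialOrderRel le ∧ ∀ D, IsWpoOn le D

/-- The semantics based on the order `le`: the `le`-minimal matches among those
with the same endpoints. -/
def OrderSem (le : Walk → Walk → Prop) (D : Database) (R : RE) : Set Walk :=
  {w ∈ Matches D R | ∀ w' ∈ Matches D R, w'.ep = w.ep → le w' w → w' = w}

def Monotonous (S : Database → RE → Set Walk) : Prop :=
  ∀ D D' R, D.Sub D' → S D R ⊆ S D' R

def CoMonotonous (S : Database → RE → Set Walk) : Prop :=
  ∀ D D' R, D.Sub D' → S D' R ∩ Walks D ⊆ S D R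

def Stabilizing (S : Database → RE → Set Walk) : Prop :=
  ∀ (D : Database) (Rs : ℕ → RE),
    (∀ i j, i ≤ j → ∀ u, u ∈ (Rs i).matches' → u ∈ (Rs j).matches') →
    ∃ N, ∀ n, N ≤ n → S D (Rs n) = S D (Rs N)

/-- Concatenation lifted to sets of walks. -/
def setConcat (W W' : Set Walk) : Set Walk :=
  {u | ∃ w ∈ W, ∃ w' ∈ W', w.tgt = w'.src ∧ u = w.concat w'}

/-- `setStar W` : all concatenations `w₁·…·w_k` (k ≥ 1) of walks of `W`. -/
inductive setStar (W : Set Walk) : Walk → Prop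
  | base : ∀ w ∈ W, setStar W w
  | step : ∀ u w, setStar W u → w ∈ W → u.tgt = w.src → setStar W (u.concat w)

/-- Walks jointly consistent with some database. -/
def ConsistentPair (w w' : Walk) : Prop :=
  ∃ D : Database, w.Consistent D ∧ w'.Consistent D

/-- The trimming of an order. -/
def trimRel (le : Walk → Walk → Prop) (w w' : Walk) : Prop :=
  ConsistentPair w w' ∧ w.ep = w'.ep ∧ le w w'

def Trimmed (le : Walk → Walk → Prop) : Prop := trimRel le = le

/-- `le` respects element inclusion. -/
def RespectsElemIncl (le : Walk → Walk → Prop) : Prop :=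
  ∀ w w', le w w' →
    (∀ v ∈ w.vertexList, v ∈ w'.vertexList) ∧ ∀ e ∈ w.edgeList, e ∈ w'.edgeList

/-- Action of a relabeling on a database. -/
def Database.relabel (π : Equiv.Perm Lab) (D : Database) : Database where
  labels := D.labels.image (⇑π)
  verts := D.verts
  edges := D.edges
  src := D.src
  tgt := D.tgt
  lbl := fun e => π (D.lbl e)
  src_mem := D.src_mem
  tgt_mem := D.tgt_mem
  lbl_mem := fun e he => Finset.mem_image_of_mem (⇑π) (D.lbl_mem e he)

/-- Action of a renaming on a walk. -/
def Walk.rename (νv : Equiv.Perm V) (νe : Equiv.Perm Edg) (w : Walk) : Walk :=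
  ⟨νv w.head, w.steps.map fun p => (νe p.1, νv p.2)⟩

/-- Action of a renaming on a database. -/
def Database.rename (νv : Equiv.Perm V) (νe : Equiv.Perm Edg) (D : Database) :
    Database where
  labels := D.labels
  verts := D.verts.image (⇑νv)
  edges := D.edges.image (⇑νe)
  src := fun e => νv (D.src (νe.symm e))
  tgt := fun e => νv (D.tgt (νe.symm e))
  lbl := fun e => D.lbl (νe.symm e)
  src_mem := by
    intro e he
    obtain ⟨e', he', rfl⟩ := Finset.mem_image.mp he
    simpa using Finset.mem_image_of_mem (⇑νv) (D.src_mem e' he')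
  tgt_mem := by
    intro e he
    obtain ⟨e', he', rfl⟩ := Finset.mem_image.mp he
    simpa using Finset.mem_image_of_mem (⇑νv) (D.tgt_mem e' he')
  lbl_mem := by
    intro e he
    obtain ⟨e', he', rfl⟩ := Finset.mem_image.mp he
    simpa using D.lbl_mem e' he'

/-- Identifier independence. -/
def IdIndependent (S : Database → RE → Set Walk) : Prop :=
  ∀ (νv : Equiv.Perm V) (νe : Equiv.Perm Edg) (D : Database) (R : RE),
    Walk.rename νv νe '' S D R = S (Database.rename νv νe D) R

/-- Unbounded semantics. -/
def Unbounded (S : Database → RE → Set Walk) : Prop :=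
  ∀ n : ℕ, ∃ (D : Database) (R : RE) (w : Walk), w ∈ S D R ∧ n ≤ w.length

/-- Shortest-walk semantics. -/
def Sh (D : Database) (R : RE) : Set Walk :=
  {w ∈ Matches D R | ∀ w' ∈ Matches D R, w'.ep = w.ep → w.length ≤ w'.length}

/-- The factor-inserting relation `F`. -/
def FactorIns (w w' : Walk) : Prop :=
  ∃ w₁ w₂ w₃ : Walk, w₁.tgt = w₂.src ∧ w₂.tgt = w₃.src ∧ w₁.tgt = w₃.src ∧
    w = w₁.concat w₃ ∧ w' = (w₁.concat w₂).concat w₃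

/-- The subwalk order: reflexive–transitive closure of `FactorIns`. -/
def SubwalkOrd : Walk → Walk → Prop := Relation.ReflTransGen FactorIns

/-- A regular expression denoting the set of all words over a given list of letters. -/
def allWords {α : Type*} (l : List α) : RegularExpression α :=
  .star (l.foldr (fun a P => .plus (.char a) P) .zero)

lemma singleton_mem_matches'_foldr {α : Type*} {l : List α} {a : α} (ha : a ∈ l) :
    [a] ∈ (l.foldr (fun a P => RegularExpression.plus (.char a) P) .zero).matches' := by
  induction l with
  | nil => simp at ha
  | cons b l ih =>
    rcases List.mem_cons.mp ha with rfl | h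
    · exact Or.inl rfl
    · exact Or.inr (ih h)

lemma mem_matches'_allWords {α : Type*} {l u : List α} (hu : ∀ a ∈ u, a ∈ l) :
    u ∈ (allWords l).matches' := by
  refine Language.mem_kstar.mpr ⟨u.map fun a => [a], by rw [← List.flatMap_def, List.flatMap_singleton'], ?_⟩
  intro y hy
  obtain ⟨a, ha, rfl⟩ := List.mem_map.mp hy
  exact singleton_mem_matches'_foldr (hu a ha)

lemma chainFrom.fst_mem_edges {D : Database} {v : V} {l : List (Edg × V)}
    (h : chainFrom D v l) : ∀ p ∈ l, p.1 ∈ D.edges := by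
  induction l generalizing v with
  | nil => simp
  | cons q l ih =>
    obtain ⟨he, -, -, h⟩ := h
    exact List.forall_mem_cons.mpr ⟨he, ih h⟩

lemma Walk.Consistent.mem_matches_allWords {D : Database} {w : Walk} (hw : w.Consistent D) :
    w ∈ Matches D (allWords D.labels.toList) := by
  refine ⟨hw, mem_matches'_allWords fun a ha => ?_⟩
  obtain ⟨p, hp, rfl⟩ := List.mem_map.mp ha
  exact Finset.mem_toList.mpr (D.lbl_mem _ (chainFrom.fst_mem_edges hw.2 p hp))

lemma finite_consistent_of_isSemantics_filterSem {f : Walk → Bool}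
    (hf : IsSemantics (FilterSem f)) (D : Database) :
    {w : Walk | w.Consistent D ∧ f w = true}.Finite :=
  (hf D (allWords D.labels.toList)).2.subset fun _ hw => ⟨hw.1.mem_matches_allWords, hw.2⟩

/-- A non-decreasing sequence of sets with finite union eventually equals its union. -/
lemma exists_forall_ge_eq_iUnion_of_finite {α : Type*} {A : ℕ → Set α} (hA : Monotone A)
    (hfin : (⋃ i, A i).Finite) : ∃ N, ∀ n, N ≤ n → A n = ⋃ i, A i := by
  have h : ∀ᶠ n in Filter.atTop, ∀ a ∈ ⋃ i, A i, a ∈ A n := by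
    refine (Filter.eventually_all_finite hfin).mpr fun a ha => ?_
    obtain ⟨i, hi⟩ := Set.mem_iUnion.mp ha
    exact Filter.eventually_atTop.mpr ⟨i, fun n hn => hA hn hi⟩
  obtain ⟨N, hN⟩ := Filter.eventually_atTop.mp h
  exact ⟨N, fun n hn => (Set.subset_iUnion A n).antisymm (hN n hn)⟩

lemma exists_forall_ge_filterSem_eq_iUnion {f : Walk → Bool} (hf : IsSemantics (FilterSem f))
    (D : Database) {Rs : ℕ → RE}
    (hRs : ∀ i j, i ≤ j → ∀ u, u ∈ (Rs i).matches' → u ∈ (Rs j).matches') :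
    ∃ N, ∀ n, N ≤ n → FilterSem f D (Rs n) = ⋃ i, FilterSem f D (Rs i) := by
  refine exists_forall_ge_eq_iUnion_of_finite
    (fun i j hij w hw => ⟨⟨hw.1.1, hRs i j hij _ hw.1.2⟩, hw.2⟩) ?_
  exact (finite_consistent_of_isSemantics_filterSem hf D).subset
    (Set.iUnion_subset fun i w hw => ⟨hw.1.1, hw.2⟩)

/-- Every filter-based semantics is continuous. -/
theorem every_filterBased_continuous
    (S : Database → RE → Set Walk) (hS : IsSemantics S) (f : Walk → Bool)
    (hf : ∀ D R, S D R = FilterSem f D R) :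
    Stabilizing S ∧
      ∀ (D : Database) (Rs : ℕ → RE),
        (∀ i j, i ≤ j → ∀ u, u ∈ (Rs i).matches' → u ∈ (Rs j).matches') →
        ∀ Rinf : RE, (∀ u, u ∈ Rinf.matches' ↔ ∃ i, u ∈ (Rs i).matches') →
          ∃ N, ∀ n, N ≤ n → S D (Rs n) = S D Rinf := by
  obtain rfl : S = FilterSem f := funext fun D => funext (hf D)
  refine ⟨fun D Rs hRs => ?_, fun D Rs hRs Rinf hinf => ?_⟩
  · obtain ⟨N, hN⟩ := exists_forall_ge_filterSem_eq_iUnion hS D hRs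
    exact ⟨N, fun n hn => (hN n hn).trans (hN N le_rfl).symm⟩
  · obtain ⟨N, hN⟩ := exists_forall_ge_filterSem_eq_iUnion hS D hRs
    refine ⟨N, fun n hn => (hN n hn).trans (Set.ext fun w => ?_)⟩
    simp only [Set.mem_iUnion, FilterSem, Matches, Set.mem_ofPred_eq, hinf]
    tauto

end RPQ
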